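/- Let q ≡ 1 (mod 5), let ψ ∈ F_q^*, and let χ be a multiplicative character of F_q^* of order 5. Then N_{(0,1,2,3,4),χ}(q) = 0 if ψ^5 ≠ 1, and N_{(0,1,2,3,4),χ}(q) = q^2 if ψ^5 = 1. -/

import Mathlib

/-- The group of multiplicative characters of a finite field with values in `ℂ` is finite. -/
noncomputable instance {F : Type*} [Field F] [Fintype F] : Fintype (MulChar F ℂ) :=
  Fintype.ofFinite _

/-- The Gauss sum `G(φ, χ) = ∑_{x ∈ F*} φ(x) χ(x)`. -/
noncomputable def gaussSum' {F : Type*} [Field F] [Fintype F]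
    (φ : AddChar F ℂ) (χ : MulChar F ℂ) : ℂ :=
  letI := Classical.decEq F
  ∑ x : Fˣ, φ (x : F) * χ (x : F)

/-- `z` is the number of indices `j` such that `χ^{s_j} η` is trivial. -/
noncomputable def zNum {F : Type*} [Field F] [Fintype F]
    (χ η : MulChar F ℂ) (s : Fin 5 → ℤ) : ℕ :=
  letI := Classical.decEq (MulChar F ℂ)
  (Finset.univ.filter (fun j : Fin 5 => χ ^ s j * η = 1)).card

/-- `δ = 0` if `z ≥ 1` and `δ = 1` if `z = 0`. -/
noncomputable def deltaNum {F : Type*} [Field F] [Fintype F]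
    (χ η : MulChar F ℂ) (s : Fin 5 → ℤ) : ℕ :=
  if 1 ≤ zNum χ η s then 0 else 1

/-- `N_{(s₁,…,s₅),χ}(q) = (1/(q-1)) ∑_η q^{5-z-δ} G(φ,η⁵) / (∏_j G(φ,χ^{s_j} η)) η(1/(5ψ)⁵)`. -/
noncomputable def Ntuple {F : Type*} [Field F] [Fintype F]
    (φ : AddChar F ℂ) (χ : MulChar F ℂ) (ψ : F) (s : Fin 5 → ℤ) : ℂ :=
  (1 / ((Fintype.card F : ℂ) - 1)) *
    ∑ η : MulChar F ℂ,
      (Fintype.card F : ℂ) ^ ((5 : ℤ) - zNum χ η s - deltaNum χ η s) *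
        gaussSum' φ (η ^ 5) / (∏ j : Fin 5, gaussSum' φ (χ ^ s j * η)) *
        η ((((5 : F) * ψ) ^ 5)⁻¹)

section

open Polynomial

section CharacteristicPolynomial

variable {F E : Type*} [Field F] [Field E] [Algebra F E] [FiniteDimensional F E]

/-- The characteristic polynomial of multiplication by `a`, as a power of the minimal
polynomial. -/
noncomputable def fieldCharpoly (F : Type*) {E : Type*} [Field F] [Field E] [Algebra F E]
    (a : E) : F[X] :=
  minpoly F a ^ (Module.finrank F E / (minpoly F a).natDegree)

theorem fieldCharpoly_monic (a : E) : (fieldCharpoly F a).Monic :=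
  (minpoly.monic (Algebra.IsIntegral.isIntegral a)).pow _

theorem map_fieldCharpoly [IsGalois F E] (a : E) :
    (fieldCharpoly F a).map (algebraMap F E) = ∏ σ : E ≃ₐ[F] E, (X - C (σ a)) := by
  have hint : IsIntegral F a := Algebra.IsIntegral.isIntegral a
  obtain ⟨p, hp⟩ := (mem_lifts _).mp
    (Algebra.IsInvariant.charpoly_mem_lifts F E (E ≃ₐ[F] E) a)
  simp only [MulSemiringAction.charpoly_eq, AlgEquiv.smul_def] at hp
  have hmonic : p.Monic := by
    refine monic_of_injective (algebraMap F E).injective ?_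
    rw [hp]
    exact monic_prod_of_monic _ _ fun σ _ => monic_X_sub_C _
  have hdvd : p ∣ minpoly F a ^ Fintype.card (E ≃ₐ[F] E) := by
    rw [← Polynomial.map_dvd_map' (algebraMap F E), hp, Polynomial.map_pow,
      ← Finset.card_univ, ← Finset.prod_const]
    refine Finset.prod_dvd_prod_of_dvd _ _ fun σ _ => ?_
    rw [dvd_iff_isRoot, IsRoot.def, eval_map_algebraMap, aeval_algHom_apply σ a]
    simp
  obtain ⟨r, -, hr⟩ := (dvd_prime_pow (minpoly.prime hint) _).mp hdvd
  have hr' : p = minpoly F a ^ r :=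
    eq_of_monic_of_associated hmonic ((minpoly.monic hint).pow r) hr
  have hdeg : Module.finrank F E = r * (minpoly F a).natDegree := by
    rw [← natDegree_pow, ← hr', ← natDegree_map (algebraMap F E), hp,
      natDegree_prod_of_monic _ _ fun σ _ => monic_X_sub_C _]
    simp [← IsGalois.card_aut_eq_finrank]
  rw [← hp, hr', fieldCharpoly, hdeg, Nat.mul_div_cancel _ (minpoly.natDegree_pos hint)]

theorem natDegree_fieldCharpoly [IsGalois F E] (a : E) :
    (fieldCharpoly F a).natDegree = Module.finrank F E := by
  rw [← natDegree_map (algebraMap F E), map_fieldCharpoly,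
    natDegree_prod_of_monic _ _ fun σ _ => monic_X_sub_C _]
  simp [← IsGalois.card_aut_eq_finrank]

end CharacteristicPolynomial

section PowerSums

variable {R S : Type*} [CommRing R] [CommRing S]

/-- The sum of the roots of a monic polynomial. -/
noncomputable def rootSum (f : R[X]) : R := -f.reverse.coeff 1

/-- The sum of the fifth powers of the roots of a monic polynomial, by Newton's identities. -/
noncomputable def rootFifthPowerSum (f : R[X]) : R :=
  let c := f.reverse.coeff
  5 * c 1 ^ 3 * c 2 - 5 * c 1 ^ 2 * c 3 - 5 * c 1 * c 2 ^ 2 + 5 * c 1 * c 4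
    + 5 * c 2 * c 3 - 5 * c 5 - c 1 ^ 5

/-- The product of the roots of a monic polynomial. -/
noncomputable def rootProd (f : R[X]) : R := (-1) ^ f.natDegree * f.coeff 0

theorem Polynomial.Monic.reverse_mul {f g : R[X]} (hf : f.Monic) (hg : g.Monic) :
    (f * g).reverse = f.reverse * g.reverse := by
  nontriviality R
  exact Polynomial.reverse_mul (by simp [hf.leadingCoeff, hg.leadingCoeff])

theorem Polynomial.Monic.coeff_zero_reverse {f : R[X]} (hf : f.Monic) :
    f.reverse.coeff 0 = 1 := by
  rw [Polynomial.coeff_zero_reverse, hf.leadingCoeff]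

theorem rootSum_mul {f g : R[X]} (hf : f.Monic) (hg : g.Monic) :
    rootSum (f * g) = rootSum f + rootSum g := by
  simp only [rootSum, hf.reverse_mul hg, coeff_mul,
    Finset.Nat.sum_antidiagonal_eq_sum_range_succ_mk, Finset.sum_range_succ,
    Finset.sum_range_zero]
  simp only [hf.coeff_zero_reverse, hg.coeff_zero_reverse, Nat.sub_self, Nat.sub_zero]
  ring

theorem rootFifthPowerSum_mul {f g : R[X]} (hf : f.Monic) (hg : g.Monic) :
    rootFifthPowerSum (f * g) = rootFifthPowerSum f + rootFifthPowerSum g := by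
  simp only [rootFifthPowerSum, hf.reverse_mul hg, coeff_mul,
    Finset.Nat.sum_antidiagonal_eq_sum_range_succ_mk, Finset.sum_range_succ,
    Finset.sum_range_zero]
  simp only [hf.coeff_zero_reverse, hg.coeff_zero_reverse, Nat.reduceSub, Nat.sub_self, Nat.sub_zero]
  ring

theorem rootProd_mul {f g : R[X]} (hf : f.Monic) (hg : g.Monic) :
    rootProd (f * g) = rootProd f * rootProd g := by
  simp only [rootProd, hf.natDegree_mul hg, mul_coeff_zero]
  ring

theorem reverse_X_sub_C [Nontrivial R] (a : R) : (X - C a).reverse = 1 - C a * X := by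
  have h : X - C a = C 1 * X + C (-a) := by simp [sub_eq_add_neg]
  rw [h, reverse_add_C, reverse_mul_X, reverse_C]
  simp [sub_eq_add_neg]

theorem rootSum_X_sub_C [Nontrivial R] (a : R) : rootSum (X - C a) = a := by
  simp [rootSum, reverse_X_sub_C, coeff_one]

theorem rootFifthPowerSum_X_sub_C [Nontrivial R] (a : R) :
    rootFifthPowerSum (X - C a) = a ^ 5 := by
  simp [rootFifthPowerSum, reverse_X_sub_C, coeff_one]
  ring

theorem rootProd_X_sub_C [Nontrivial R] (a : R) : rootProd (X - C a) = a := by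
  simp [rootProd]

theorem reverse_map_of_injective {i : R →+* S} (hi : Function.Injective i) (f : R[X]) :
    (f.map i).reverse = f.reverse.map i := by
  rw [reverse, reverse, natDegree_map_eq_of_injective hi, reflect_map]

variable {i : R →+* S}

theorem rootSum_map (hi : Function.Injective i) (f : R[X]) :
    rootSum (f.map i) = i (rootSum f) := by
  simp [rootSum, reverse_map_of_injective hi]

theorem rootFifthPowerSum_map (hi : Function.Injective i) (f : R[X]) :
    rootFifthPowerSum (f.map i) = i (rootFifthPowerSum f) := by
  simp only [rootFifthPowerSum, reverse_map_of_injective hi, coeff_map, map_sub, map_add,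
    map_mul, map_pow, map_ofNat]

theorem rootProd_map (hi : Function.Injective i) (f : R[X]) :
    rootProd (f.map i) = i (rootProd f) := by
  simp [rootProd, natDegree_map_eq_of_injective hi]

end PowerSums

section Galois

variable {F E : Type*} [Field F] [Field E] [Algebra F E] [FiniteDimensional F E] [IsGalois F E]

theorem apply_prod_X_sub_C_of_mul {R : Type*} [CommRing R] {ι M : Type*} [CommMonoid M]
    (w : R[X] → M) (h1 : w 1 = 1)
    (hmul : ∀ f g : R[X], f.Monic → g.Monic → w (f * g) = w f * w g) (s : Finset ι) (v : ι → R) :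
    w (∏ j ∈ s, (X - C (v j))) = ∏ j ∈ s, w (X - C (v j)) := by
  classical
  induction s using Finset.induction_on with
  | empty => simpa using h1
  | insert j s hj ih =>
    rw [Finset.prod_insert hj, Finset.prod_insert hj,
      hmul _ _ (monic_X_sub_C _) (monic_prod_of_monic _ _ fun σ _ => monic_X_sub_C _), ih]

theorem reverse_one' {R : Type*} [CommRing R] : (1 : R[X]).reverse = 1 := by
  rw [← C_1, reverse_C]

theorem rootProd_fieldCharpoly (a : E) :
    rootProd (fieldCharpoly F a) = Algebra.norm F a := by
  apply (algebraMap F E).injective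
  rw [← rootProd_map (algebraMap F E).injective, map_fieldCharpoly,
    apply_prod_X_sub_C_of_mul rootProd (by simp [rootProd]) fun f g => rootProd_mul,
    Algebra.norm_eq_prod_automorphisms]
  simp [rootProd_X_sub_C]

theorem rootSum_fieldCharpoly (a : E) :
    rootSum (fieldCharpoly F a) = Algebra.trace F E a := by
  apply (algebraMap F E).injective
  rw [← rootSum_map (algebraMap F E).injective, map_fieldCharpoly, trace_eq_sum_automorphisms]
  have h := apply_prod_X_sub_C_of_mul (fun f : E[X] => Multiplicative.ofAdd (rootSum f))
    (by simp [rootSum, reverse_one', coeff_one])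
    (fun f g hf hg => by simp [rootSum_mul hf hg]) Finset.univ (fun σ : E ≃ₐ[F] E => σ a)
  simpa [rootSum_X_sub_C, ← ofAdd_sum] using h

theorem rootFifthPowerSum_fieldCharpoly (a : E) :
    rootFifthPowerSum (fieldCharpoly F a) = Algebra.trace F E (a ^ 5) := by
  apply (algebraMap F E).injective
  rw [← rootFifthPowerSum_map (algebraMap F E).injective, map_fieldCharpoly,
    trace_eq_sum_automorphisms]
  have h := apply_prod_X_sub_C_of_mul (fun f : E[X] => Multiplicative.ofAdd (rootFifthPowerSum f))
    (by simp [rootFifthPowerSum, reverse_one', coeff_one])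
    (fun f g hf hg => by simp [rootFifthPowerSum_mul hf hg]) Finset.univ
    (fun σ : E ≃ₐ[F] E => σ a)
  simpa [rootFifthPowerSum_X_sub_C, ← ofAdd_sum] using h

end Galois

section Counting

theorem card_filter_dvd_div_le {D e d : ℕ} (hD : 0 < D) (hd : e * D ≤ d) :
    ((Finset.range d).filter fun k => D ∣ k + 1 ∧ (k + 1) / D ≤ e).card = e := by
  conv_rhs => rw [← Finset.card_range e]
  symm
  refine Finset.card_bij (fun i _ => (i + 1) * D - 1) ?_ ?_ ?_
  · intro i hi
    rw [Finset.mem_range] at hi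
    have h1 : (i + 1) * D ≤ e * D := Nat.mul_le_mul_right D hi
    have h2 : 0 < (i + 1) * D := by positivity
    have h3 : (i + 1) * D - 1 + 1 = (i + 1) * D := by omega
    simp only [Finset.mem_filter, Finset.mem_range, h3]
    refine ⟨by omega, Dvd.intro_left _ rfl, ?_⟩
    rw [Nat.mul_div_cancel _ hD]
    exact hi
  · intro i _ j _ hij
    have h2 : 0 < (i + 1) * D := by positivity
    have h3 : 0 < (j + 1) * D := by positivity
    have h4 : (i + 1) * D = (j + 1) * D := by omega
    have := Nat.eq_of_mul_eq_mul_right hD h4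
    omega
  · intro k hk
    simp only [Finset.mem_filter, Finset.mem_range] at hk
    obtain ⟨hk, ⟨i, hi⟩, hle⟩ := hk
    rw [hi, Nat.mul_div_cancel_left _ hD] at hle
    have hi0 : i ≠ 0 := by rintro rfl; simp at hi
    refine ⟨i - 1, by rw [Finset.mem_range]; omega, ?_⟩
    rw [Nat.sub_add_cancel (by omega), mul_comm, ← hi]
    rfl

variable {F E : Type*} [Field F] [Finite F] [Field E] [Fintype E] [Algebra F E]

open Classical in
theorem card_filter_minpoly_eq {P : F[X]} (hP : Irreducible P) (hm : P.Monic)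
    (hdvd : P.natDegree ∣ Module.finrank F E) :
    (Finset.univ.filter fun a : E => minpoly F a = P).card = P.natDegree := by
  have := Fintype.ofFinite F
  have hne : (X ^ Fintype.card E - X : F[X]) ≠ 0 :=
    FiniteField.X_pow_card_sub_X_ne_zero F Fintype.one_lt_card
  have hPX : P ∣ X ^ Fintype.card E - X := by
    rw [Module.card_eq_pow_finrank (K := F), Fintype.card_eq_nat_card]
    exact hP.natDegree_dvd_iff_dvd_X_pow_card_pow_sub_X.mp hdvd
  have hsplit : (P.map (algebraMap F E)).Splits :=
    (FiniteField.isSplittingField_sub E F).splits.of_dvd (Polynomial.map_ne_zero hne)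
      ((Polynomial.map_dvd_map' _).mpr hPX)
  have hroots : (Finset.univ.filter fun a : E => minpoly F a = P) = (P.aroots E).toFinset := by
    ext a
    simp only [Finset.mem_filter, Finset.mem_univ, true_and, Multiset.mem_toFinset,
      mem_aroots, ne_eq, hP.ne_zero, not_false_eq_true]
    constructor
    · rintro rfl
      exact minpoly.aeval F a
    · exact fun h => (minpoly.eq_of_irreducible_of_monic hP h hm).symm
  rw [hroots, aroots_def, Multiset.toFinset_card_of_nodup
    (nodup_roots (PerfectField.separable_of_irreducible hP).map),
    ← hsplit.natDegree_eq_card_roots, natDegree_map]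

omit [Finite F] in
theorem minpoly_dvd_fieldCharpoly (a : E) : minpoly F a ∣ fieldCharpoly F a := by
  have := Module.Finite.of_finite (R := F) (M := E)
  refine dvd_pow_self _ fun h => ?_
  have h' := natDegree_fieldCharpoly (F := F) a
  rw [fieldCharpoly, h, pow_zero, natDegree_one] at h'
  exact Module.finrank_pos.ne h'

omit [Finite F] in
theorem natDegree_minpoly_dvd_finrank (a : E) :
    (minpoly F a).natDegree ∣ Module.finrank F E := by
  have := Module.Finite.of_finite (R := F) (M := E)
  rw [← natDegree_fieldCharpoly (F := F) a, fieldCharpoly, natDegree_pow]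
  exact Dvd.intro_left _ rfl

open Classical UniqueFactorizationMonoid in
theorem card_filter_fieldCharpoly_dvd {f : F[X]} (hf : f ≠ 0) :
    (Finset.univ.filter fun a : E => fieldCharpoly F a ∣ f).card =
      ∑ P ∈ (normalizedFactors f).toFinset,
        if P.natDegree ∣ Module.finrank F E ∧
          Module.finrank F E / P.natDegree ≤ (normalizedFactors f).count P
        then P.natDegree else 0 := by
  have := Module.Finite.of_finite (R := F) (M := E)
  have hirr (a : E) : Irreducible (minpoly F a) :=
    minpoly.irreducible (Algebra.IsIntegral.isIntegral a)
  have hnorm (a : E) : normalize (minpoly F a) = minpoly F a :=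
    (minpoly.monic (Algebra.IsIntegral.isIntegral a)).normalize_eq_self
  rw [Finset.card_eq_sum_card_fiberwise (f := fun a => minpoly F a)
    (t := (normalizedFactors f).toFinset)]
  · refine Finset.sum_congr rfl fun P hP => ?_
    rw [Multiset.mem_toFinset] at hP
    have hPirr := irreducible_of_normalized_factor P hP
    have hPnorm := normalize_normalized_factor P hP
    have hmonic : P.Monic := by
      rw [← hPnorm]
      exact monic_normalize hPirr.ne_zero
    rw [Finset.filter_filter]
    have hcond (a : E) (ha : minpoly F a = P) : fieldCharpoly F a ∣ f ↔
        Module.finrank F E / P.natDegree ≤ (normalizedFactors f).count P := by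
      rw [fieldCharpoly, ha, pow_dvd_iff_le_emultiplicity,
        emultiplicity_eq_count_normalizedFactors hPirr hf, hPnorm, Nat.cast_le]
    split_ifs with h
    · rw [← card_filter_minpoly_eq (E := E) hPirr hmonic h.1]
      congr 1
      refine Finset.filter_congr fun a _ => ⟨fun h' => h'.2, fun h' => ⟨?_, h'⟩⟩
      exact (hcond a h').mpr h.2
    · rw [Finset.card_eq_zero, Finset.filter_eq_empty_iff]
      rintro a - ⟨h1, h2⟩
      refine h ⟨?_, (hcond a h2).mp h1⟩
      rw [← h2]
      exact natDegree_minpoly_dvd_finrank a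
  · intro a ha
    simp only [Finset.coe_filter, Finset.mem_univ, true_and, Set.mem_ofPred_eq] at ha
    simp only [Finset.mem_coe, Multiset.mem_toFinset]
    obtain ⟨Q, hQ, hQ'⟩ := exists_mem_normalizedFactors_of_dvd hf (hirr a)
      ((minpoly_dvd_fieldCharpoly a).trans ha)
    have := normalize_eq_normalize_iff_associated.mpr hQ'
    rw [hnorm, normalize_normalized_factor Q hQ] at this
    rwa [this]

variable (p : ℕ) [Fact p.Prime] [CharP F p]

noncomputable instance (k : ℕ) [NeZero k] : Fintype (FiniteField.Extension F p k) :=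
  Fintype.ofFinite _

open Classical UniqueFactorizationMonoid in
theorem sum_card_filter_fieldCharpoly_dvd {f : F[X]} (hf : f.Monic) {d : ℕ}
    (hd : f.natDegree ≤ d) :
    ∑ k ∈ Finset.range d,
      (Finset.univ.filter
        fun a : FiniteField.Extension F p (k + 1) => fieldCharpoly F a ∣ f).card =
      f.natDegree := by
  have hdeg : ∑ P ∈ (normalizedFactors f).toFinset,
      (normalizedFactors f).count P * P.natDegree = f.natDegree := by
    have h := Finset.sum_multiset_map_count (normalizedFactors f) natDegree
    simp only [smul_eq_mul] at h
    rw [← h, ← natDegree_multiset_prod _ (zero_notMem_normalizedFactors f)]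
    exact natDegree_eq_of_degree_eq
      (degree_eq_degree_of_associated (prod_normalizedFactors hf.ne_zero))
  simp only [card_filter_fieldCharpoly_dvd hf.ne_zero, FiniteField.finrank_extension]
  rw [Finset.sum_comm]
  conv_rhs => rw [← hdeg]
  refine Finset.sum_congr rfl fun P hP => ?_
  have hle : (normalizedFactors f).count P * P.natDegree ≤ d := by
    refine le_trans ?_ (hdeg.le.trans hd)
    exact Finset.single_le_sum (f := fun P => (normalizedFactors f).count P * P.natDegree)
      (fun _ _ => Nat.zero_le _) hP
  rw [Multiset.mem_toFinset] at hP
  rw [← Finset.sum_filter, Finset.sum_const, smul_eq_mul,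
    card_filter_dvd_div_le (irreducible_of_normalized_factor P hP).natDegree_pos hle]

end Counting

section Newton

variable (F : Type*) [Field F] [Finite F]

theorem finite_setOf_monic_natDegree_eq (n : ℕ) :
    {f : F[X] | f.Monic ∧ f.natDegree = n}.Finite := by
  have : Finite (degreeLT F n) := Finite.of_equiv _ (degreeLTEquiv F n).toEquiv.symm
  exact Finite.of_equiv _ (monicEquivDegreeLT (R := F) n).symm

/-- The monic polynomials of degree `n` over a finite field. -/
noncomputable def monicsOfDegree (n : ℕ) : Finset F[X] :=
  (finite_setOf_monic_natDegree_eq F n).toFinset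

variable {F}

@[simp]
theorem mem_monicsOfDegree {n : ℕ} {f : F[X]} :
    f ∈ monicsOfDegree F n ↔ f.Monic ∧ f.natDegree = n := by
  simp [monicsOfDegree]

theorem monicsOfDegree_zero : monicsOfDegree F 0 = {1} := by
  ext f
  simp only [mem_monicsOfDegree, Finset.mem_singleton]
  exact ⟨fun h => h.1.natDegree_eq_zero.mp h.2, by rintro rfl; simp⟩

/-- The degree `n` coefficient of the `L`-function of a weight on monic polynomials. -/
noncomputable def lCoeff (w : F[X] → ℂ) (n : ℕ) : ℂ := ∑ f ∈ monicsOfDegree F n, w f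

variable (p : ℕ) [Fact p.Prime] [CharP F p]

/-- The sum of a weight over the characteristic polynomials of the elements of the extension of
degree `k`. -/
noncomputable def lPowerSum (w : F[X] → ℂ) (k : ℕ) [NeZero k] : ℂ :=
  ∑ a : FiniteField.Extension F p k, w (fieldCharpoly F a)

theorem sum_filter_dvd_monicsOfDegree {w : F[X] → ℂ}
    (hw : ∀ f g : F[X], f.Monic → g.Monic → w (f * g) = w f * w g) {g : F[X]} (hg : g.Monic)
    [DecidablePred fun f : F[X] => g ∣ f] {d : ℕ} (hd : g.natDegree ≤ d) :
    ∑ f ∈ (monicsOfDegree F d).filter (fun f => g ∣ f), w f =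
      w g * lCoeff w (d - g.natDegree) := by
  rw [lCoeff, Finset.mul_sum]
  symm
  refine Finset.sum_bij (fun h _ => g * h) ?_ ?_ ?_ ?_
  · intro h hh
    rw [mem_monicsOfDegree] at hh
    rw [Finset.mem_filter, mem_monicsOfDegree, hg.natDegree_mul hh.1]
    exact ⟨⟨hg.mul hh.1, by omega⟩, dvd_mul_right _ _⟩
  · intro _ _ _ _ h
    exact mul_left_cancel₀ hg.ne_zero h
  · intro f hf
    rw [Finset.mem_filter, mem_monicsOfDegree] at hf
    obtain ⟨⟨hf, hdeg⟩, h, rfl⟩ := hf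
    have hh : h.Monic := hg.of_mul_monic_left hf
    rw [hg.natDegree_mul hh] at hdeg
    exact ⟨h, by rw [mem_monicsOfDegree]; exact ⟨hh, by omega⟩, rfl⟩
  · intro h hh
    rw [mem_monicsOfDegree] at hh
    exact (hw g h hg hh.1).symm

theorem natCast_mul_lCoeff {w : F[X] → ℂ}
    (hw : ∀ f g : F[X], f.Monic → g.Monic → w (f * g) = w f * w g) (d : ℕ) :
    d * lCoeff w d =
      ∑ k ∈ Finset.range d, lPowerSum p w (k + 1) * lCoeff w (d - (k + 1)) := by
  classical
  calc
    d * lCoeff w d = ∑ f ∈ monicsOfDegree F d, ∑ k ∈ Finset.range d,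
        ∑ a : FiniteField.Extension F p (k + 1), if fieldCharpoly F a ∣ f then w f else 0 := by
      rw [lCoeff, Finset.mul_sum]
      refine Finset.sum_congr rfl fun f hf => ?_
      rw [mem_monicsOfDegree] at hf
      conv_lhs => rw [← hf.2, ← sum_card_filter_fieldCharpoly_dvd p hf.1 hf.2.le]
      simp only [Nat.cast_sum, Finset.sum_mul, ← Finset.sum_filter, Finset.sum_const,
        nsmul_eq_mul]
    _ = ∑ k ∈ Finset.range d, ∑ a : FiniteField.Extension F p (k + 1),
        ∑ f ∈ monicsOfDegree F d, if fieldCharpoly F a ∣ f then w f else 0 := by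
      rw [Finset.sum_comm]
      exact Finset.sum_congr rfl fun k _ => Finset.sum_comm
    _ = _ := by
      refine Finset.sum_congr rfl fun k hk => ?_
      rw [lPowerSum, Finset.sum_mul]
      refine Finset.sum_congr rfl fun a _ => ?_
      have hdeg : (fieldCharpoly F a).natDegree = k + 1 := by
        rw [natDegree_fieldCharpoly, FiniteField.finrank_extension]
      rw [← Finset.sum_filter, sum_filter_dvd_monicsOfDegree hw (fieldCharpoly_monic a), hdeg]
      rw [hdeg]
      exact Finset.mem_range.mp hk

end Newton

section GaussWeight

variable {F : Type*} [Field F]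

/-- The weight `f ↦ θ(∏ xᵢ) φ(s(f))` on monic polynomials `f` with roots `xᵢ`. -/
noncomputable def gaussWeight (φ : AddChar F ℂ) (θ : MulChar F ℂ) (s : F[X] → F) (f : F[X]) : ℂ :=
  θ (rootProd f) * φ (s f)

variable {φ : AddChar F ℂ} (θ : MulChar F ℂ)

theorem gaussWeight_mul {s : F[X] → F}
    (hs : ∀ f g : F[X], f.Monic → g.Monic → s (f * g) = s f + s g) (f g : F[X]) (hf : f.Monic)
    (hg : g.Monic) : gaussWeight φ θ s (f * g) = gaussWeight φ θ s f * gaussWeight φ θ s g := by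
  rw [gaussWeight, rootProd_mul hf hg, hs f g hf hg, map_mul, AddChar.map_add_eq_mul]
  simp only [gaussWeight]
  ring

variable [Fintype F]

theorem gaussSum'_eq (φ : AddChar F ℂ) : gaussSum' φ θ = gaussSum θ φ := by
  classical
  rw [gaussSum', gaussSum, ← Finset.sum_erase (s := Finset.univ) (f := fun x : F => θ x * φ x)
    (a := 0) (by simp [MulChar.map_zero])]
  refine Finset.sum_bij (fun x _ => (x : F)) (by simp) (by simp [Units.ext_iff]) ?_ ?_
  · intro x hx
    exact ⟨Units.mk0 x (Finset.ne_of_mem_erase hx), Finset.mem_univ _, rfl⟩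
  · intro x _
    exact mul_comm _ _

theorem lCoeff_gaussWeight_zero {s : F[X] → F} (hs : s 1 = 0) :
    lCoeff (gaussWeight φ θ s) 0 = 1 := by
  simp [lCoeff, monicsOfDegree_zero, gaussWeight, hs, rootProd]

theorem lCoeff_gaussWeight_one : lCoeff (gaussWeight φ θ rootSum) 1 = gaussSum θ φ := by
  rw [lCoeff, gaussSum]
  symm
  refine Finset.sum_bij (fun a _ => X - C a) ?_ ?_ ?_ ?_
  · intro a _
    simpa using monic_X_sub_C a
  · intro a _ b _ h
    simpa using h
  · intro f hf
    rw [mem_monicsOfDegree] at hf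
    refine ⟨-f.coeff 0, Finset.mem_univ _, ?_⟩
    conv_rhs => rw [hf.1.eq_X_add_C hf.2]
    simp
  · intro a _
    rw [gaussWeight, rootProd_X_sub_C, rootSum_X_sub_C]

omit [Fintype F] in
theorem rootSum_add_C_mul_X_pow {f : F[X]} {n : ℕ} (hf : f.Monic) (hn : f.natDegree = n + 1)
    (c : F) : rootSum (f + C c * X ^ n) = rootSum f - c := by
  have hlt : (C c * X ^ n).degree < f.degree := by
    rw [degree_eq_natDegree hf.ne_zero, hn]
    exact (degree_C_mul_X_pow_le _ _).trans_lt (by norm_cast; omega)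
  have hdeg := (natDegree_add_eq_left_of_degree_lt hlt).trans hn
  rw [rootSum, rootSum, coeff_one_reverse, coeff_one_reverse, nextCoeff_of_natDegree_pos (by omega),
    nextCoeff_of_natDegree_pos (by omega), hdeg, hn]
  simp
  ring

theorem lCoeff_gaussWeight_eq_zero (hφ : φ ≠ 1) (n : ℕ) :
    lCoeff (gaussWeight φ θ rootSum) (n + 2) = 0 := by
  obtain ⟨c, hc⟩ : ∃ c, φ c ≠ 1 := by
    by_contra! h
    exact hφ (DFunLike.ext _ _ h)
  have hdeg (b : F) : (C b * X ^ (n + 1)).degree < ((n + 2 : ℕ) : WithBot ℕ) :=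
    (degree_C_mul_X_pow_le _ _).trans_lt (by norm_cast; omega)
  have hmem (b : F) (f : F[X]) (hf : f ∈ monicsOfDegree F (n + 2)) :
      f + C b * X ^ (n + 1) ∈ monicsOfDegree F (n + 2) := by
    rw [mem_monicsOfDegree] at hf ⊢
    have hlt : (C b * X ^ (n + 1)).degree < f.degree := by
      rw [degree_eq_natDegree hf.1.ne_zero, hf.2]
      exact hdeg b
    exact ⟨hf.1.add_of_left hlt, (natDegree_add_eq_left_of_degree_lt hlt).trans hf.2⟩
  have h : lCoeff (gaussWeight φ θ rootSum) (n + 2) =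
      φ c * lCoeff (gaussWeight φ θ rootSum) (n + 2) := by
    rw [lCoeff, Finset.mul_sum]
    refine Finset.sum_nbij' (fun f => f + C c * X ^ (n + 1))
      (fun f => f + C (-c) * X ^ (n + 1)) (hmem _) (hmem _) (by simp) (by simp) ?_
    intro f hf
    have hf' := hmem c f hf
    rw [mem_monicsOfDegree] at hf hf'
    have hprod : rootProd (f + C c * X ^ (n + 1)) = rootProd f := by
      simp [rootProd, hf.2, hf'.2]
    have hsum : rootSum f = rootSum (f + C c * X ^ (n + 1)) + c := by
      rw [rootSum_add_C_mul_X_pow hf.1 hf.2]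
      ring
    rw [gaussWeight, gaussWeight, hprod, hsum, AddChar.map_add_eq_mul]
    ring
  have h' : (1 - φ c) * lCoeff (gaussWeight φ θ rootSum) (n + 2) = 0 := by
    linear_combination h
  exact (mul_eq_zero.mp h').resolve_left (sub_ne_zero.mpr hc.symm)

end GaussWeight

section FifthPowers

variable {F : Type*} [Field F] [Fintype F] {χ : MulChar F ℂ}

theorem exists_isPrimitiveRoot_five (hq : Fintype.card F % 5 = 1) :
    ∃ ζ : F, IsPrimitiveRoot ζ 5 := by
  classical
  have : Fact (Nat.Prime 5) := ⟨by norm_num⟩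
  have hdvd : 5 ∣ Nat.card Fˣ := by
    rw [Nat.card_eq_fintype_card, Fintype.card_units]
    omega
  obtain ⟨u, hu⟩ := exists_prime_orderOf_dvd_card' 5 hdvd
  exact ⟨u, IsPrimitiveRoot.coe_units_iff.mpr (hu ▸ IsPrimitiveRoot.orderOf u)⟩

omit [Fintype F] in
theorem apply_pow_five_eq_one (hχ : orderOf χ = 5) {x : F} (hx : x ≠ 0) : χ x ^ 5 = 1 := by
  rw [← MulChar.pow_apply' _ (by norm_num), ← hχ, pow_orderOf_eq_one,
    MulChar.one_apply (isUnit_iff_ne_zero.mpr hx)]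

variable {E : Type*} [Field E] [Fintype E] [Algebra F E]

omit [Fintype F] in
theorem exists_pow_five_eq_iff [Finite F] (hχ : orderOf χ = 5) {b : E} (hb : b ≠ 0) :
    (∃ a : E, a ^ 5 = b) ↔ χ (Algebra.norm F b) = 1 := by
  have := Module.Finite.of_finite (R := F) (M := E)
  have hprime : Fact (Nat.Prime 5) := ⟨by norm_num⟩
  constructor
  · rintro ⟨a, rfl⟩
    have ha : a ≠ 0 := fun h => hb (by simp [h])
    rw [map_pow, map_pow, apply_pow_five_eq_one hχ (Algebra.norm_ne_zero_iff.mpr ha)]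
  · intro h
    obtain ⟨g, hg⟩ := IsCyclic.exists_generator (α := Eˣ)
    have hpow (u : Eˣ) : ∃ m : ℕ, g ^ m = u :=
      mem_powers_iff_mem_zpowers.mpr (hg u)
    have hg1 : χ (Algebra.norm F (g : E)) ≠ 1 := by
      intro h1
      have hχ1 : χ = 1 := by
        refine MulChar.ext fun x => ?_
        obtain ⟨u, hu⟩ := FiniteField.norm_surjective F E (x : F)
        have hu0 : u ≠ 0 := by
          rintro rfl
          rw [Algebra.norm_zero] at hu
          exact x.ne_zero hu.symm
        obtain ⟨m, hm⟩ := hpow (Units.mk0 u hu0)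
        have hm' : (g : E) ^ m = u := by
          simpa using congrArg Units.val hm
        rw [MulChar.one_apply_coe, ← hu, ← hm', map_pow, map_pow, h1, one_pow]
      rw [hχ1, orderOf_one] at hχ
      norm_num at hχ
    have hord : orderOf (χ (Algebra.norm F (g : E))) = 5 :=
      orderOf_eq_prime
        (apply_pow_five_eq_one hχ (Algebra.norm_ne_zero_iff.mpr g.ne_zero)) hg1
    obtain ⟨m, hm⟩ := hpow (Units.mk0 b hb)
    have hm' : (g : E) ^ m = b := by
      simpa using congrArg Units.val hm
    rw [← hm', map_pow, map_pow] at h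
    obtain ⟨r, rfl⟩ := hord ▸ orderOf_dvd_of_pow_eq_one h
    exact ⟨(g : E) ^ r, by rw [← hm', ← pow_mul, mul_comm]⟩

open Classical in
theorem card_filter_pow_five_eq (hq : Fintype.card F % 5 = 1) (hχ : orderOf χ = 5) {b : E}
    (hb : b ≠ 0) :
    ((Finset.univ.filter fun a : E => a ^ 5 = b).card : ℂ) =
      ∑ j ∈ Finset.range 5, χ (Algebra.norm F b) ^ j := by
  obtain ⟨ζ, hζ⟩ := exists_isPrimitiveRoot_five hq
  have hζE : IsPrimitiveRoot (algebraMap F E ζ) 5 :=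
    hζ.map_of_injective (algebraMap F E).injective
  have hset : (Finset.univ.filter fun a : E => a ^ 5 = b) = (nthRoots 5 b).toFinset := by
    ext a
    simp [mem_nthRoots]
  have := Module.Finite.of_finite (R := F) (M := E)
  rw [hset, Multiset.toFinset_card_of_nodup (hζE.nthRoots_nodup hb), hζE.card_nthRoots,
    exists_pow_five_eq_iff hχ hb]
  split_ifs with h
  · simp [h]
  · have h5 := apply_pow_five_eq_one hχ (Algebra.norm_ne_zero_iff.mpr hb : Algebra.norm F b ≠ 0)
    rw [geom_sum_eq h, h5]
    simp

variable {φ : AddChar F ℂ}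

theorem sum_norm_trace_pow_five (hq : Fintype.card F % 5 = 1) (hχ : orderOf χ = 5)
    (θ : MulChar F ℂ) :
    ∑ a : E, (θ ^ 5) (Algebra.norm F a) * φ (Algebra.trace F E (a ^ 5)) =
      ∑ j ∈ Finset.range 5,
        ∑ b : E, (χ ^ j * θ) (Algebra.norm F b) * φ (Algebra.trace F E b) := by
  classical
  have := Module.Finite.of_finite (R := F) (M := E)
  calc
    _ = ∑ a : E, θ (Algebra.norm F (a ^ 5)) * φ (Algebra.trace F E (a ^ 5)) := by
      simp [MulChar.pow_apply' θ (n := 5) (by norm_num)]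
    _ = ∑ b : E, ∑ a : E with a ^ 5 = b,
        θ (Algebra.norm F (a ^ 5)) * φ (Algebra.trace F E (a ^ 5)) :=
      (Finset.sum_fiberwise _ _ _).symm
    _ = ∑ b : E, ∑ j ∈ Finset.range 5,
        (χ ^ j * θ) (Algebra.norm F b) * φ (Algebra.trace F E b) := by
      refine Finset.sum_congr rfl fun b _ => ?_
      rw [Finset.sum_congr rfl (g := fun _ => θ (Algebra.norm F b) * φ (Algebra.trace F E b))
        fun a ha => by rw [(Finset.mem_filter.mp ha).2], Finset.sum_const, nsmul_eq_mul]
      rcases eq_or_ne b 0 with rfl | hb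
      · simp [Algebra.norm_zero, MulChar.map_zero]
      · rw [card_filter_pow_five_eq hq hχ hb, Finset.sum_mul]
        refine Finset.sum_congr rfl fun j _ => ?_
        have hu := (Algebra.norm_ne_zero_iff.mpr hb : Algebra.norm F b ≠ 0)
        have hj : (χ ^ j) (Algebra.norm F b) = χ (Algebra.norm F b) ^ j :=
          MulChar.pow_apply_coe χ j (Units.mk0 _ hu)
        rw [MulChar.mul_apply, hj]
        ring
    _ = _ := Finset.sum_comm

variable (p : ℕ) [Fact p.Prime] [CharP F p]

theorem lPowerSum_rootFifthPowerSum (hq : Fintype.card F % 5 = 1) (hχ : orderOf χ = 5)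
    (θ : MulChar F ℂ) (k : ℕ) [NeZero k] :
    lPowerSum p (gaussWeight φ (θ ^ 5) rootFifthPowerSum) k =
      ∑ j ∈ Finset.range 5, lPowerSum p (gaussWeight φ (χ ^ j * θ) rootSum) k := by
  simp only [lPowerSum, gaussWeight, rootProd_fieldCharpoly, rootSum_fieldCharpoly,
    rootFifthPowerSum_fieldCharpoly]
  exact sum_norm_trace_pow_five hq hχ θ

end FifthPowers

section LiftedGaussSums

/-- Newton's identities for five variables, solved for the top elementary symmetric function. -/
theorem eq_prod_of_newton {g₀ g₁ g₂ g₃ g₄ l₁ l₂ l₃ l₄ l₅ : ℂ} {s : ℕ → ℂ}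
    (hs : ∀ k, s k = (-1) ^ k * (g₀ ^ (k + 1) + g₁ ^ (k + 1) + g₂ ^ (k + 1) + g₃ ^ (k + 1)
      + g₄ ^ (k + 1)))
    (h₁ : l₁ = s 0) (h₂ : 2 * l₂ = s 0 * l₁ + s 1) (h₃ : 3 * l₃ = s 0 * l₂ + s 1 * l₁ + s 2)
    (h₄ : 4 * l₄ = s 0 * l₃ + s 1 * l₂ + s 2 * l₁ + s 3)
    (h₅ : 5 * l₅ = s 0 * l₄ + s 1 * l₃ + s 2 * l₂ + s 3 * l₁ + s 4) :
    l₅ = g₀ * g₁ * g₂ * g₃ * g₄ := by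
  obtain rfl : l₂ = (s 0 * l₁ + s 1) / 2 := by linear_combination h₂ / 2
  obtain rfl : l₃ = (s 0 * ((s 0 * l₁ + s 1) / 2) + s 1 * l₁ + s 2) / 3 := by
    linear_combination h₃ / 3
  subst h₁
  simp only [hs] at h₄ h₅
  linear_combination h₅ / 5 + (g₀ + g₁ + g₂ + g₃ + g₄) * h₄ / 20

variable {F : Type*} [Field F] [Fintype F] {φ : AddChar F ℂ} (p : ℕ) [Fact p.Prime] [CharP F p]

/-- The Davenport–Hasse lifting relation. -/
theorem lPowerSum_rootSum (hφ : φ ≠ 1) (θ : MulChar F ℂ) (k : ℕ) :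
    lPowerSum p (gaussWeight φ θ rootSum) (k + 1) = (-1) ^ k * gaussSum θ φ ^ (k + 1) := by
  have hnewton := natCast_mul_lCoeff p
    (gaussWeight_mul (φ := φ) θ fun _ _ => rootSum_mul)
  have h0 : lCoeff (gaussWeight φ θ rootSum) 0 = 1 :=
    lCoeff_gaussWeight_zero θ (by simp [rootSum, reverse_one', coeff_one])
  induction k with
  | zero => simpa [h0, lCoeff_gaussWeight_one] using (hnewton 1).symm
  | succ k ih =>
    have h := hnewton (k + 2)
    rw [lCoeff_gaussWeight_eq_zero θ hφ, Finset.sum_range_succ, Finset.sum_range_succ,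
      Finset.sum_eq_zero] at h
    · have h1 : k + 2 - (k + 1) = 1 := by omega
      have h2 : k + 2 - (k + 1 + 1) = 0 := by omega
      rw [h1, h2, h0, lCoeff_gaussWeight_one, ih] at h
      rw [pow_succ (-1 : ℂ) k, pow_succ _ (k + 1)]
      linear_combination -h
    · intro i hi
      rw [Finset.mem_range] at hi
      obtain ⟨m, hm⟩ : ∃ m, k + 2 - (i + 1) = m + 2 := ⟨k - 1 - i, by omega⟩
      rw [hm, lCoeff_gaussWeight_eq_zero θ hφ, mul_zero]

theorem lCoeff_five_rootFifthPowerSum (hq : Fintype.card F % 5 = 1) (hφ : φ ≠ 1)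
    {χ : MulChar F ℂ} (hχ : orderOf χ = 5) (θ : MulChar F ℂ) :
    lCoeff (gaussWeight φ (θ ^ 5) rootFifthPowerSum) 5 =
      ∏ j ∈ Finset.range 5, gaussSum (χ ^ j * θ) φ := by
  have : Fact (ringChar F).Prime := ⟨CharP.char_is_prime F _⟩
  have hnewton := natCast_mul_lCoeff (ringChar F)
    (gaussWeight_mul (φ := φ) (θ ^ 5) fun _ _ => rootFifthPowerSum_mul)
  have h0 : lCoeff (gaussWeight φ (θ ^ 5) rootFifthPowerSum) 0 = 1 :=
    lCoeff_gaussWeight_zero _ (by simp [rootFifthPowerSum, reverse_one', coeff_one])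
  have h1 := hnewton 1
  have h2 := hnewton 2
  have h3 := hnewton 3
  have h4 := hnewton 4
  have h5 := hnewton 5
  simp only [Finset.sum_range_succ, Finset.sum_range_zero, Nat.reduceAdd, Nat.reduceSub, h0,
    zero_add, mul_one, Nat.cast_ofNat, Nat.cast_one, one_mul] at h1 h2 h3 h4 h5
  simp only [Finset.prod_range_succ, Finset.prod_range_zero, one_mul]
  refine eq_prod_of_newton
    (s := fun k => lPowerSum (ringChar F) (gaussWeight φ (θ ^ 5) rootFifthPowerSum) (k + 1))
    (fun k => ?_) h1 h2 h3 h4 h5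
  simp only [lPowerSum_rootFifthPowerSum _ hq hχ, lPowerSum_rootSum _ hφ, Finset.sum_range_succ,
    Finset.sum_range_zero]
  ring

end LiftedGaussSums

section ExplicitQuintics

variable {F : Type*} [Field F] [Fintype F] {φ : AddChar F ℂ}

theorem lCoeff_five_rootFifthPowerSum_eq_sum (θ : MulChar F ℂ) :
    lCoeff (gaussWeight φ θ rootFifthPowerSum) 5 =
      ∑ a : F, ∑ b : F, ∑ c : F, ∑ e : F, ∑ d : F, θ (-e) *
        φ (5 * a ^ 3 * b - 5 * a ^ 2 * c - 5 * a * b ^ 2 + 5 * a * d + 5 * b * c - 5 * e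
          - a ^ 5) := by
  simp only [← Fintype.sum_prod_type']
  rw [lCoeff]
  symm
  refine Finset.sum_bij (fun v _ => X ^ 5 + C v.1 * X ^ 4 + C v.2.1 * X ^ 3 + C v.2.2.1 * X ^ 2
    + C v.2.2.2.2 * X + C v.2.2.2.1) ?_ ?_ ?_ ?_
  · intro v _
    rw [mem_monicsOfDegree]
    exact ⟨by monicity!, by compute_degree!⟩
  · intro v _ w _ h
    have hcoeff (n : ℕ) := congrArg (fun f : F[X] => f.coeff n) h
    have h0 := hcoeff 0
    have h1 := hcoeff 1
    have h2 := hcoeff 2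
    have h3 := hcoeff 3
    have h4 := hcoeff 4
    simp [coeff_X, coeff_C] at h0 h1 h2 h3 h4
    ext <;> assumption
  · intro f hf
    rw [mem_monicsOfDegree] at hf
    refine ⟨⟨f.coeff 4, f.coeff 3, f.coeff 2, f.coeff 0, f.coeff 1⟩, Finset.mem_univ _, ?_⟩
    have h5 : f.coeff 5 = 1 := hf.2 ▸ hf.1.coeff_natDegree
    conv_rhs => rw [f.as_sum_range_C_mul_X_pow, hf.2]
    simp only [Finset.sum_range_succ, Finset.sum_range_zero, h5]
    simp
    ring
  · intro v _
    have hdeg : (X ^ 5 + C v.1 * X ^ 4 + C v.2.1 * X ^ 3 + C v.2.2.1 * X ^ 2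
        + C v.2.2.2.2 * X + C v.2.2.2.1).natDegree = 5 := by compute_degree!
    rw [gaussWeight, rootProd, rootFifthPowerSum, hdeg]
    simp only [coeff_reverse, hdeg, revAt_le (show 1 ≤ 5 by norm_num),
      revAt_le (show 2 ≤ 5 by norm_num), revAt_le (show 3 ≤ 5 by norm_num),
      revAt_le (show 4 ≤ 5 by norm_num), revAt_le (show 5 ≤ 5 by norm_num)]
    congr 2
    · simp
      ring
    · simp [coeff_X, coeff_C]

theorem lCoeff_five_rootFifthPowerSum_eq_gaussSum (hφ : φ ≠ 1) (h5 : (5 : F) ≠ 0)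
    (θ : MulChar F ℂ) :
    lCoeff (gaussWeight φ θ rootFifthPowerSum) 5 =
      (Fintype.card F : ℂ) ^ 2 * ((θ 5)⁻¹ * gaussSum θ φ) := by
  classical
  have hprim : φ.IsPrimitive := AddChar.IsPrimitive.of_ne_one hφ
  have hsum (b : F) : ∑ d : F, φ (5 * b * d) = if b = 0 then (Fintype.card F : ℂ) else 0 := by
    have h := AddChar.sum_mulShift (5 * b) hprim
    simp only [mul_eq_zero, h5, false_or, Nat.cast_ite, Nat.cast_zero] at h
    rw [← h]
    exact Finset.sum_congr rfl fun d _ => by rw [mul_comm]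
  have hsplit (a b c e d : F) : θ (-e) *
        φ (5 * a ^ 3 * b - 5 * a ^ 2 * c - 5 * a * b ^ 2 + 5 * a * d + 5 * b * c - 5 * e
          - a ^ 5) = θ (-e) *
        φ (5 * a ^ 3 * b - 5 * a ^ 2 * c - 5 * a * b ^ 2 + 5 * b * c - 5 * e
          - a ^ 5) * φ (5 * a * d) := by
    rw [mul_assoc (θ _), ← AddChar.map_add_eq_mul]
    ring_nf
  have hsplit' (b c e : F) : θ (-e) * φ (5 * b * c - 5 * e) * (Fintype.card F : ℂ) =
      φ (5 * b * c) * (Fintype.card F * (θ (-e) * φ (5 * -e))) := by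
    rw [sub_eq_add_neg, AddChar.map_add_eq_mul]
    ring_nf
  have hshift : θ 5 * ∑ e : F, θ (-e) * φ (5 * -e) = gaussSum θ φ := by
    rw [← gaussSum_mulShift θ φ (Units.mk0 5 h5), gaussSum]
    congr 1
    exact Fintype.sum_equiv (Equiv.neg F) _ _ fun e => by simp [AddChar.mulShift_apply]
  have hθ : θ 5 ≠ 0 := ((isUnit_iff_ne_zero.mpr h5).map θ).ne_zero
  rw [lCoeff_five_rootFifthPowerSum_eq_sum]
  simp only [hsplit, ← Finset.mul_sum, hsum, mul_ite, mul_zero, Finset.sum_ite_irrel,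
    Finset.sum_const_zero, Finset.sum_ite_eq', Finset.mem_univ, if_true]
  simp [hsplit', ← Finset.mul_sum, ← Finset.sum_mul, hsum]
  rw [← hshift, inv_mul_cancel_left₀ hθ]
  ring_nf

end ExplicitQuintics

end

section DavenportHasse

variable {F : Type*} [Field F] [Fintype F] {φ : AddChar F ℂ} {χ : MulChar F ℂ}

/-- The Davenport–Hasse product formula for characters of order five. -/
theorem prod_gaussSum_eq (hq : Fintype.card F % 5 = 1) (hφ : φ ≠ 1) (h5 : (5 : F) ≠ 0)
    (hχ : orderOf χ = 5) (θ : MulChar F ℂ) :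
    ∏ j ∈ Finset.range 5, gaussSum (χ ^ j * θ) φ =
      (Fintype.card F : ℂ) ^ 2 * ((θ (5 ^ 5))⁻¹ * gaussSum (θ ^ 5) φ) := by
  rw [← lCoeff_five_rootFifthPowerSum hq hφ hχ, lCoeff_five_rootFifthPowerSum_eq_gaussSum hφ h5,
    MulChar.pow_apply' _ (by norm_num), map_pow]

theorem gaussSum_ne_zero (hφ : φ ≠ 1) (θ : MulChar F ℂ) : gaussSum θ φ ≠ 0 := by
  have hprim := AddChar.IsPrimitive.of_ne_one hφ
  rcases eq_or_ne θ 1 with rfl | hθ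
  · simp [gaussSum_one_left, hφ]
  · exact gaussSum_ne_zero_of_nontrivial (by simp) hθ hprim

omit [Fintype F] in
theorem zpow_vec_apply (χ : MulChar F ℂ) (j : Fin 5) :
    χ ^ (![0, 1, 2, 3, 4] : Fin 5 → ℤ) j = χ ^ (j : ℕ) := by
  fin_cases j <;> rfl

theorem zNum_le_one (hχ : orderOf χ = 5) (η : MulChar F ℂ) : zNum χ η ![0, 1, 2, 3, 4] ≤ 1 := by
  rw [zNum, Finset.card_le_one]
  intro i hi j hj
  simp only [Finset.mem_filter, Finset.mem_univ, true_and, zpow_vec_apply] at hi hj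
  exact Fin.ext (pow_injOn_Iio_orderOf (by simp [hχ]) (by simp [hχ])
    (mul_right_cancel (hi.trans hj.symm)))

theorem five_sub_zNum_sub_deltaNum (hχ : orderOf χ = 5) (η : MulChar F ℂ) :
    (5 : ℤ) - zNum χ η ![0, 1, 2, 3, 4] - deltaNum χ η ![0, 1, 2, 3, 4] = 4 := by
  have := zNum_le_one hχ η
  rw [deltaNum]
  split_ifs <;> push_cast <;> omega

theorem sum_mulChar_apply_eq_zero {x : F} (hx : x ≠ 1) : ∑ η : MulChar F ℂ, η x = 0 := by
  obtain ⟨θ, hθ⟩ := MulChar.exists_apply_ne_one_of_hasEnoughRootsOfUnity F ℂ hx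
  have h : θ x * ∑ η : MulChar F ℂ, η x = ∑ η : MulChar F ℂ, η x := by
    rw [Finset.mul_sum]
    exact Fintype.sum_equiv (Equiv.mulLeft θ) _ _ fun η => rfl
  rw [← sub_eq_zero, ← sub_one_mul] at h
  exact (mul_eq_zero.mp h).resolve_left (sub_ne_zero.mpr hθ)

theorem card_mulChar : (Fintype.card (MulChar F ℂ) : ℂ) = Fintype.card F - 1 := by
  classical
  rw [← Nat.card_eq_fintype_card, MulChar.card_eq_card_units_of_hasEnoughRootsOfUnity,
    Nat.card_eq_fintype_card, Fintype.card_units, Nat.cast_pred Fintype.card_pos]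

theorem Ntuple_eq_sum (hq : Fintype.card F % 5 = 1) (hφ : φ ≠ 1) (h5 : (5 : F) ≠ 0)
    (hχ : orderOf χ = 5) (ψ : F) :
    Ntuple φ χ ψ ![0, 1, 2, 3, 4] = (Fintype.card F : ℂ) ^ 2 *
      ((1 / ((Fintype.card F : ℂ) - 1)) * ∑ η : MulChar F ℂ, η (ψ ^ 5)⁻¹) := by
  rw [Ntuple, mul_left_comm, Finset.mul_sum (a := (Fintype.card F : ℂ) ^ 2)]
  congr 1
  refine Finset.sum_congr rfl fun η _ => ?_
  have hprod : ∏ j : Fin 5, gaussSum' φ (χ ^ (![0, 1, 2, 3, 4] : Fin 5 → ℤ) j * η) =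
      (Fintype.card F : ℂ) ^ 2 * ((η (5 ^ 5))⁻¹ * gaussSum (η ^ 5) φ) := by
    rw [← prod_gaussSum_eq hq hφ h5 hχ]
    simp only [gaussSum'_eq, zpow_vec_apply]
    exact Fin.prod_univ_eq_prod_range (fun j => gaussSum (χ ^ j * η) φ) 5
  have hη : η (5 ^ 5) ≠ 0 := (((isUnit_iff_ne_zero.mpr h5).pow 5).map η).ne_zero
  have hcard : (Fintype.card F : ℂ) ≠ 0 := by simp
  have hinv : η ((5 * ψ) ^ 5)⁻¹ = (η (5 ^ 5))⁻¹ * η (ψ ^ 5)⁻¹ := by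
    rw [mul_pow, mul_inv, map_mul]
    congr 1
    exact eq_inv_of_mul_eq_one_left (by rw [← map_mul, inv_mul_cancel₀ (pow_ne_zero 5 h5), map_one])
  have hG := gaussSum_ne_zero hφ (η ^ 5)
  rw [hprod, five_sub_zNum_sub_deltaNum hχ, gaussSum'_eq, hinv]
  field_simp

end DavenportHasse

/-- Let `F` be a finite field with `q ≡ 1 (mod 5)` elements of
characteristic `p ≠ 5`, let `ψ ∈ F*`, and let `χ` be a multiplicative character of `F` of
order `5`. Then `N_{(0,1,2,3,4),χ}(q) = 0` if `ψ⁵ ≠ 1`, and `N_{(0,1,2,3,4),χ}(q) = q²`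
if `ψ⁵ = 1`. -/
theorem stmt_16 {F : Type*} [Field F] [Fintype F] (hchar : ringChar F ≠ 5)
    (hq : Fintype.card F % 5 = 1) (ψ : F) (hψ : ψ ≠ 0)
    (φ : AddChar F ℂ) (hφ : φ ≠ 1) (χ : MulChar F ℂ) (hχ : orderOf χ = 5) :
    (ψ ^ 5 ≠ 1 → Ntuple φ χ ψ ![0, 1, 2, 3, 4] = 0) ∧
      (ψ ^ 5 = 1 → Ntuple φ χ ψ ![0, 1, 2, 3, 4] = (Fintype.card F : ℂ) ^ 2) := by
  have h5 : (5 : F) ≠ 0 := by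
    intro h
    have hdvd : ringChar F ∣ 5 := ringChar.dvd (by exact_mod_cast h)
    rcases (Nat.dvd_prime (by norm_num)).mp hdvd with h1 | h1
    · exact CharP.ringChar_ne_one h1
    · exact hchar h1
  rw [Ntuple_eq_sum hq hφ h5 hχ]
  constructor
  · intro h
    rw [sum_mulChar_apply_eq_zero (inv_ne_one.mpr h), mul_zero, mul_zero]
  · intro h
    have hcard : (Fintype.card F : ℂ) - 1 ≠ 0 := by
      rw [sub_ne_zero]
      exact_mod_cast Fintype.one_lt_card.ne'
    simp only [h, inv_one, map_one, Finset.sum_const, Finset.card_univ, nsmul_eq_mul, mul_one,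
      card_mulChar]
    rw [one_div_mul_cancel hcard, mul_one]
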